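/- arXiv:math/0303281 — 2 statements merged into one kernel-verified Lean document; each statement's English description precedes it below -/
import Mathlib

section
/- Let Θ' ⊆ Θ ⊆ I, and let w₁ ∈ W^{Θ∪Θ^⊥}, w₂ ∈ ^ΘW, w₁' ∈ W^{Θ'∪Θ'^⊥}, w₂' ∈ ^{Θ'}W. Then the following are equivalent: (ii) there exists w ∈ W_{Θ'^⊥} such that w₁ ≥ (w₁'w)^Θ and w₂ ≤ ^Θ(w⁻¹w₂') in the Bruhat order; (iii) there exists w ∈ W_{Θ'^⊥}·W_Θ (a product of an element of W_{Θ'^⊥} and an element of W_Θ) such that w₁ ≥ w₁'w and w₂ ≤ w⁻¹w₂' in the Bruhat order. -/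
open Classical

namespace Paper

variable {B : Type*} {M : CoxeterMatrix B} {W : Type*} [Group W]

/-- `Θ^⊥`: the indices whose simple reflections commute with all simple
reflections indexed by `Θ` (i.e. `m(i,j) = 2` for all `j ∈ Θ`). -/
def perp (M : CoxeterMatrix B) (Θ : Set B) : Set B := {i | i ∉ Θ ∧ ∀ j ∈ Θ, M i j = 2}

variable (cs : CoxeterSystem M W)

/-- The standard parabolic subgroup `W_J` generated by the simple reflections indexed by `J`. -/
def parabolic (J : Set B) : Subgroup W := Subgroup.closure (cs.simple '' J)

/-- `W^J`: the minimal-length representatives of the cosets `W/W_J`,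
`{w : ℓ(wu) = ℓ(w) + ℓ(u) for all u ∈ W_J}`. -/
def minRight (J : Set B) : Set W :=
  {w | ∀ u ∈ parabolic cs J, cs.length (w * u) = cs.length w + cs.length u}

/-- `^JW`: the minimal-length representatives of the cosets `W_J\W`,
`{w : ℓ(uw) = ℓ(u) + ℓ(w) for all u ∈ W_J}`. -/
def minLeft (J : Set B) : Set W :=
  {w | ∀ u ∈ parabolic cs J, cs.length (u * w) = cs.length u + cs.length w}

/-- The Bruhat order on `W`: `x ≤ y` iff `y` is obtained from `x` by a chain of
right multiplications by reflections, each strictly increasing the length. -/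
def bruhatLE : W → W → Prop :=
  Relation.ReflTransGen (fun x y => ∃ t, cs.IsReflection t ∧ y = x * t ∧ cs.length x < cs.length y)

/-- The equivalence relation `∼_Θ` on `W × W`:
`(x,y) ∼_Θ (x',y')` iff there are `u ∈ W_{Θ∪Θ^⊥}` and `v ∈ W_Θ` with `x' = xu`, `y' = u⁻¹vy`. -/
def simRel (Θ : Set B) (p q : W × W) : Prop :=
  ∃ u ∈ parabolic cs (Θ ∪ perp M Θ), ∃ v ∈ parabolic cs Θ,
    q.1 = p.1 * u ∧ q.2 = u⁻¹ * v * p.2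

/-- `w^J`: the minimal-length element of the coset `w W_J`. -/
noncomputable def projR (J : Set B) (w : W) : W :=
  if h : ∃ a, a ∈ minRight cs J ∧ a⁻¹ * w ∈ parabolic cs J then h.choose else w

/-- `^Jw`: the minimal-length element of the coset `W_J w`. -/
noncomputable def projL (J : Set B) (w : W) : W :=
  if h : ∃ a, a ∈ minLeft cs J ∧ w * a⁻¹ ∈ parabolic cs J then h.choose else w

/-- The simple reflection `i` acting on pairs (element, parity): it conjugates the element and
changes the parity exactly at the element `cs.simple i`. -/
noncomputable def simpleToggle (i : B) : Function.End (W × ZMod 2) :=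
  fun p => (cs.simple i * p.1 * cs.simple i, p.2 + if p.1 = cs.simple i then 1 else 0)

theorem prod_simpleToggle_apply (ω : List B) (t : W) (ε : ZMod 2) :
    (ω.map (simpleToggle cs)).prod (t, ε) =
      (cs.wordProd ω * t * (cs.wordProd ω)⁻¹, ε + ((cs.rightInvSeq ω).count t : ZMod 2)) := by
  induction ω with
  | nil => simp [Function.End.one_def]
  | cons i ω ih =>
    rw [List.map_cons, List.prod_cons]
    change simpleToggle cs i ((ω.map (simpleToggle cs)).prod (t, ε)) = _
    rw [ih]
    have key : cs.wordProd ω * t * (cs.wordProd ω)⁻¹ = cs.simple i ↔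
        (cs.wordProd ω)⁻¹ * cs.simple i * cs.wordProd ω = t := by
      constructor
      · intro h
        rw [← h]
        group
      · rintro rfl
        group
    simp only [simpleToggle, key, CoxeterSystem.rightInvSeq, List.count_cons, cs.wordProd_cons,
      mul_inv_rev, cs.inv_simple, Prod.mk.injEq, beq_iff_eq]
    refine ⟨by simp only [mul_assoc], ?_⟩
    split_ifs <;> simp [add_assoc]

theorem prod_map_alternatingWord {G : Type*} [Monoid G] (f : B → G) (i j : B) (m : ℕ) :
    ((CoxeterSystem.alternatingWord i j (2 * m)).map f).prod = (f i * f j) ^ m := by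
  induction m with
  | zero => simp [CoxeterSystem.alternatingWord]
  | succ m ih =>
    rw [show 2 * (m + 1) = 2 * m + 1 + 1 by ring, CoxeterSystem.alternatingWord_succ',
      CoxeterSystem.alternatingWord_succ']
    simp [ih, pow_succ', mul_assoc]

theorem reverse_alternatingWord (i j : B) (m : ℕ) :
    (CoxeterSystem.alternatingWord i j (2 * m)).reverse =
      CoxeterSystem.alternatingWord j i (2 * m) := by
  induction m with
  | zero => simp [CoxeterSystem.alternatingWord]
  | succ m ih =>
    rw [show 2 * (m + 1) = 2 * m + 1 + 1 by ring, CoxeterSystem.alternatingWord_succ',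
      CoxeterSystem.alternatingWord_succ', CoxeterSystem.alternatingWord_succ,
      CoxeterSystem.alternatingWord_succ]
    simp [ih]

theorem even_count_leftInvSeq_alternatingWord (i j : B) (t : W) :
    Even ((cs.leftInvSeq (CoxeterSystem.alternatingWord i j (2 * M i j))).count t) := by
  set L := cs.leftInvSeq (CoxeterSystem.alternatingWord i j (2 * M i j)) with hL
  have hlen : L.length = 2 * M i j := by simp [hL]
  have hper : L.drop (M i j) = L.take (M i j) := by
    apply List.ext_getElem
    · simp only [List.length_drop, List.length_take, hlen]
      omega
    · intro k hk hk'
      simp only [List.length_take, hlen] at hk'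
      rw [List.getElem_drop, List.getElem_take]
      simp only [hL]
      rw [cs.getElem_leftInvSeq_alternatingWord i j _ _ (by omega),
        cs.getElem_leftInvSeq_alternatingWord i j _ _ (by omega)]
      simp only [cs.prod_alternatingWord_eq_mul_pow]
      have h1 : (2 * (M i j + k) + 1) / 2 = M i j + k := by omega
      have h2 : (2 * k + 1) / 2 = k := by omega
      simp [h1, h2, pow_add]
  rw [← List.take_append_drop (M i j) L, hper, List.count_append]
  exact Even.add_self _

theorem isLiftable_simpleToggle : M.IsLiftable (simpleToggle cs) := by
  intro i j
  rw [← prod_map_alternatingWord]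
  funext ⟨t, ε⟩
  have hprod : cs.wordProd (CoxeterSystem.alternatingWord i j (2 * M i j)) = 1 := by
    rw [CoxeterSystem.wordProd, prod_map_alternatingWord, cs.simple_mul_simple_pow]
  have hcount : Even ((cs.rightInvSeq
      (CoxeterSystem.alternatingWord i j (2 * M i j))).count t) := by
    rw [← reverse_alternatingWord, cs.rightInvSeq_reverse, List.count_reverse, M.symmetric i j]
    exact even_count_leftInvSeq_alternatingWord cs j i t
  rw [prod_simpleToggle_apply, hprod, (ZMod.natCast_eq_zero_iff_even).2 hcount]
  simp [Function.End.one_def]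

/-- The parity of the number of occurrences of `t` in the right inversion sequence of any word
for `w`. -/
noncomputable def inversionParity (w t : W) : ZMod 2 :=
  (cs.lift ⟨simpleToggle cs, isLiftable_simpleToggle cs⟩ w (t, 0)).2

theorem lift_simpleToggle_wordProd (ω : List B) :
    cs.lift ⟨simpleToggle cs, isLiftable_simpleToggle cs⟩ (cs.wordProd ω) =
      (ω.map (simpleToggle cs)).prod := by
  rw [CoxeterSystem.wordProd, map_list_prod, List.map_map]
  congr 2
  funext i
  exact cs.lift_apply_simple (isLiftable_simpleToggle cs) i

theorem inversionParity_wordProd (ω : List B) (t : W) :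
    inversionParity cs (cs.wordProd ω) t = ((cs.rightInvSeq ω).count t : ZMod 2) := by
  rw [inversionParity, lift_simpleToggle_wordProd, prod_simpleToggle_apply]
  simp

theorem lift_simpleToggle_apply (w t : W) (ε : ZMod 2) :
    cs.lift ⟨simpleToggle cs, isLiftable_simpleToggle cs⟩ w (t, ε) =
      (w * t * w⁻¹, ε + inversionParity cs w t) := by
  obtain ⟨ω, rfl⟩ := cs.wordProd_surjective w
  rw [inversionParity_wordProd, lift_simpleToggle_wordProd, prod_simpleToggle_apply]

theorem inversionParity_mul (x y t : W) :
    inversionParity cs (x * y) t =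
      inversionParity cs y t + inversionParity cs x (y * t * y⁻¹) := by
  rw [inversionParity, map_mul]
  change (cs.lift ⟨simpleToggle cs, isLiftable_simpleToggle cs⟩ x
    (cs.lift ⟨simpleToggle cs, isLiftable_simpleToggle cs⟩ y (t, 0))).2 = _
  rw [lift_simpleToggle_apply, lift_simpleToggle_apply, zero_add]

theorem inversionParity_one (t : W) : inversionParity cs 1 t = 0 := by
  simpa using inversionParity_wordProd cs [] t

theorem inversionParity_self {t : W} (ht : cs.IsReflection t) : inversionParity cs t t = 1 := by
  obtain ⟨u, i, rfl⟩ := ht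
  have hs : inversionParity cs (cs.simple i) (cs.simple i) = 1 := by
    simpa using inversionParity_wordProd cs [i] (cs.simple i)
  have hu : inversionParity cs (u⁻¹) (u * cs.simple i * u⁻¹) +
      inversionParity cs u (cs.simple i) = 0 := by
    have h := inversionParity_mul cs u u⁻¹ (u * cs.simple i * u⁻¹)
    rw [mul_inv_cancel, inversionParity_one] at h
    rw [h]
    congr 2
    group
  have e1 : u⁻¹ * (u * cs.simple i * u⁻¹) * u⁻¹⁻¹ = cs.simple i := by group
  have e2 : cs.simple i * cs.simple i * (cs.simple i)⁻¹ = cs.simple i := by group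
  rw [inversionParity_mul, inversionParity_mul, e1, e2, hs, add_left_comm, hu, add_zero]

/-- The strong exchange condition. -/
theorem exists_eraseIdx_of_length_mul_lt (ω : List B) {t : W} (ht : cs.IsReflection t)
    (hlt : cs.length (cs.wordProd ω * t) < cs.length (cs.wordProd ω)) :
    ∃ j < ω.length, cs.wordProd ω * t = cs.wordProd (ω.eraseIdx j) := by
  have htt : t * t * t⁻¹ = t := by group
  have hmem : t ∈ cs.rightInvSeq ω := by
    by_contra hnot
    have h0 : inversionParity cs (cs.wordProd ω) t = 0 := by
      rw [inversionParity_wordProd, List.count_eq_zero_of_not_mem hnot, Nat.cast_zero]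
    obtain ⟨ν, hν, hνt⟩ := cs.exists_isReduced (cs.wordProd ω * t)
    have h1 : inversionParity cs (cs.wordProd ω * t) t = 1 := by
      rw [inversionParity_mul, inversionParity_self cs ht, htt, h0, add_zero]
    have hmem : t ∈ cs.rightInvSeq ν := by
      by_contra hnot'
      rw [hνt, inversionParity_wordProd, List.count_eq_zero_of_not_mem hnot'] at h1
      simp at h1
    have h2 := (cs.isRightInversion_of_mem_rightInvSeq hν hmem).2
    rw [← hνt, mul_assoc, ht.mul_self, mul_one] at h2
    omega
  obtain ⟨j, hj, hjt⟩ := List.mem_iff_getElem.mp hmem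
  refine ⟨j, by simpa using hj, ?_⟩
  rw [← cs.wordProd_mul_getD_rightInvSeq, List.getD_eq_getElem _ 1 hj, hjt]

/-- The exchange condition for left multiplication by a simple reflection. -/
theorem exists_eraseIdx_of_length_simple_mul_lt (ω : List B) {i : B}
    (hlt : cs.length (cs.simple i * cs.wordProd ω) < cs.length (cs.wordProd ω)) :
    ∃ j < ω.length, cs.simple i * cs.wordProd ω = cs.wordProd (ω.eraseIdx j) := by
  have e : cs.wordProd ω * ((cs.wordProd ω)⁻¹ * cs.simple i * cs.wordProd ω) =
      cs.simple i * cs.wordProd ω := by group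
  have ht : cs.IsReflection ((cs.wordProd ω)⁻¹ * cs.simple i * cs.wordProd ω) := by
    simpa using (cs.isReflection_simple i).conj (cs.wordProd ω)⁻¹
  rw [← e] at hlt ⊢
  exact exists_eraseIdx_of_length_mul_lt cs ω ht hlt

theorem wordProd_mem_parabolic {J : Set B} {ω : List B} (h : ∀ i ∈ ω, i ∈ J) :
    cs.wordProd ω ∈ parabolic cs J := by
  refine Subgroup.list_prod_mem _ fun x hx => ?_
  obtain ⟨i, hi, rfl⟩ := List.mem_map.mp hx
  exact Subgroup.subset_closure ⟨i, h i hi, rfl⟩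

theorem exists_word_of_mem_parabolic {J : Set B} {u : W} (hu : u ∈ parabolic cs J) :
    ∃ ω : List B, (∀ i ∈ ω, i ∈ J) ∧ cs.wordProd ω = u := by
  induction hu using Subgroup.closure_induction with
  | mem x hx =>
    obtain ⟨i, hi, rfl⟩ := hx
    exact ⟨[i], by simpa using hi, by simp⟩
  | one => exact ⟨[], by simp, by simp⟩
  | mul x y _ _ hx hy =>
    obtain ⟨ω, hω, rfl⟩ := hx
    obtain ⟨ν, hν, rfl⟩ := hy
    exact ⟨ω ++ ν, fun i hi => (List.mem_append.mp hi).elim (hω i) (hν i), cs.wordProd_append ω ν⟩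
  | inv x _ hx =>
    obtain ⟨ω, hω, rfl⟩ := hx
    exact ⟨ω.reverse, by simpa using hω, cs.wordProd_reverse ω⟩

theorem exists_isReduced_of_mem_parabolic {J : Set B} {u : W} (hu : u ∈ parabolic cs J) :
    ∃ ω : List B, (∀ i ∈ ω, i ∈ J) ∧ cs.IsReduced ω ∧ cs.wordProd ω = u := by
  obtain ⟨ω, hω, rfl⟩ := exists_word_of_mem_parabolic cs hu
  clear hu
  induction ω with
  | nil => exact ⟨[], by simp, by simp [CoxeterSystem.IsReduced], rfl⟩
  | cons i ω ih =>
    obtain ⟨ν, hνJ, hν, hνω⟩ := ih fun k hk => hω k (List.mem_cons_of_mem i hk)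
    rw [cs.wordProd_cons, ← hνω]
    have hνlen := hν.eq
    rcases cs.length_simple_mul (cs.wordProd ν) i with h | h
    · refine ⟨i :: ν, List.forall_mem_cons.2 ⟨hω i List.mem_cons_self, hνJ⟩, ?_,
        cs.wordProd_cons i ν⟩
      rw [CoxeterSystem.IsReduced, cs.wordProd_cons, h, hνlen, List.length_cons]
    · obtain ⟨j, hj, hij⟩ := exists_eraseIdx_of_length_simple_mul_lt cs ν (i := i) (by omega)
      refine ⟨ν.eraseIdx j, fun k hk => hνJ k (List.mem_of_mem_eraseIdx hk), ?_, hij.symm⟩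
      have := List.length_eraseIdx_add_one hj
      rw [CoxeterSystem.IsReduced, ← hij]
      omega

theorem isReduced_of_cons {i : B} {ω : List B} (h : cs.IsReduced (i :: ω)) : cs.IsReduced ω := by
  simpa using h.drop 1

/-- An element of minimal length in its coset `W_J w` is a minimal-length representative. -/
theorem mem_minLeft_of_forall_length_le {J : Set B} {w : W}
    (hw : ∀ u ∈ parabolic cs J, cs.length w ≤ cs.length (u * w)) : w ∈ minLeft cs J := by
  intro u hu
  obtain ⟨ω, hωJ, hω, rfl⟩ := exists_isReduced_of_mem_parabolic cs hu
  clear hu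
  rw [hω.eq]
  induction ω with
  | nil => simp
  | cons i ω ih =>
    have hωJ' : ∀ k ∈ ω, k ∈ J := fun k hk => hωJ k (List.mem_cons_of_mem i hk)
    have hω' := isReduced_of_cons cs hω
    have ih := ih hωJ' hω'
    rw [cs.wordProd_cons, List.length_cons, mul_assoc]
    rcases cs.length_simple_mul (cs.wordProd ω * w) i with h | h
    · omega
    exfalso
    obtain ⟨ν, hν, rfl⟩ := cs.exists_isReduced w
    rw [← cs.wordProd_append] at h
    obtain ⟨j, hj, hij⟩ := exists_eraseIdx_of_length_simple_mul_lt cs (ω ++ ν) (i := i) (by omega)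
    by_cases hjω : j < ω.length
    · rw [List.eraseIdx_append_of_lt_length hjω, cs.wordProd_append, cs.wordProd_append,
        ← mul_assoc, mul_left_inj, ← cs.wordProd_cons] at hij
      have h1 := hω.eq
      have h2 := cs.length_wordProd_le (ω.eraseIdx j)
      have h3 := List.length_eraseIdx_add_one hjω
      rw [hij, List.length_cons] at h1
      omega
    · rw [List.eraseIdx_append_of_length_le (not_lt.1 hjω), cs.wordProd_append,
        cs.wordProd_append] at hij
      have hjν : j - ω.length < ν.length := by
        rw [List.length_append] at hj
        omega
      have h1 := hw ((cs.wordProd ω)⁻¹ * cs.simple i * cs.wordProd ω)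
        (mul_mem (mul_mem (inv_mem (wordProd_mem_parabolic cs hωJ'))
          (Subgroup.subset_closure ⟨i, hωJ i List.mem_cons_self, rfl⟩))
          (wordProd_mem_parabolic cs hωJ'))
      rw [mul_assoc, mul_assoc, hij, inv_mul_cancel_left, hν.eq] at h1
      have h2 := cs.length_wordProd_le (ν.eraseIdx (j - ω.length))
      have h3 := List.length_eraseIdx_add_one hjν
      omega

theorem exists_mem_minLeft (J : Set B) (w : W) :
    ∃ a, a ∈ minLeft cs J ∧ w * a⁻¹ ∈ parabolic cs J := by
  let f : parabolic cs J → ℕ := fun u => cs.length (u * w)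
  obtain ⟨u, hu⟩ : ∃ u, ∀ v, f u ≤ f v :=
    ⟨Function.argmin f, fun v => Function.argmin_le f v⟩
  refine ⟨u * w, mem_minLeft_of_forall_length_le cs fun v hv => ?_, by simp⟩
  simpa only [f, Subgroup.coe_mul, mul_assoc] using hu (⟨v, hv⟩ * u)

theorem inv_mem_minRight_iff {J : Set B} {w : W} : w⁻¹ ∈ minRight cs J ↔ w ∈ minLeft cs J := by
  constructor <;> intro h u hu
  · have := h u⁻¹ (inv_mem hu)
    rw [← mul_inv_rev] at this
    simpa only [cs.length_inv, add_comm] using this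
  · have := h u⁻¹ (inv_mem hu)
    rw [← cs.length_inv] at this
    simpa [add_comm] using this

theorem projL_spec (J : Set B) (w : W) :
    projL cs J w ∈ minLeft cs J ∧ w * (projL cs J w)⁻¹ ∈ parabolic cs J := by
  have h := exists_mem_minLeft cs J w
  rw [projL, dif_pos h]
  exact h.choose_spec

theorem projR_spec (J : Set B) (w : W) :
    projR cs J w ∈ minRight cs J ∧ (projR cs J w)⁻¹ * w ∈ parabolic cs J := by
  have h : ∃ a, a ∈ minRight cs J ∧ a⁻¹ * w ∈ parabolic cs J := by
    obtain ⟨a, ha, haw⟩ := exists_mem_minLeft cs J w⁻¹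
    refine ⟨a⁻¹, (inv_mem_minRight_iff cs).2 ha, ?_⟩
    simpa using inv_mem haw
  rw [projR, dif_pos h]
  exact h.choose_spec

variable {cs}

theorem bruhatLE.refl (x : W) : bruhatLE cs x x :=
  Relation.ReflTransGen.refl

theorem bruhatLE.trans {x y z : W} (hxy : bruhatLE cs x y) (hyz : bruhatLE cs y z) :
    bruhatLE cs x z :=
  Relation.ReflTransGen.trans hxy hyz

theorem bruhatLE.inv {x y : W} (h : bruhatLE cs x y) : bruhatLE cs x⁻¹ y⁻¹ := by
  refine Relation.ReflTransGen.lift (·⁻¹) ?_ x y h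
  rintro x _ ⟨t, ht, rfl, hlt⟩
  refine ⟨x * t * x⁻¹, ht.conj x, ?_, by simpa only [cs.length_inv] using hlt⟩
  change (x * t)⁻¹ = x⁻¹ * (x * t * x⁻¹)
  rw [mul_inv_rev, ht.inv]
  group

theorem bruhatLE_simple_mul {w : W} {i : B} (h : cs.length w < cs.length (cs.simple i * w)) :
    bruhatLE cs w (cs.simple i * w) := by
  refine Relation.ReflTransGen.single ⟨w⁻¹ * cs.simple i * w, ?_, by group, h⟩
  simpa using (cs.isReflection_simple i).conj w⁻¹

theorem bruhatLE_mul_of_mem_minLeft {J : Set B} {p u : W} (hp : p ∈ minLeft cs J)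
    (hu : u ∈ parabolic cs J) : bruhatLE cs p (u * p) := by
  obtain ⟨ω, hωJ, hω, rfl⟩ := exists_isReduced_of_mem_parabolic cs hu
  clear hu
  induction ω with
  | nil => simpa using bruhatLE.refl p
  | cons i ω ih =>
    have hωJ' : ∀ k ∈ ω, k ∈ J := fun k hk => hωJ k (List.mem_cons_of_mem i hk)
    have hω' := isReduced_of_cons cs hω
    have h1 := hp _ (wordProd_mem_parabolic cs hωJ)
    have h2 := hp _ (wordProd_mem_parabolic cs hωJ')
    rw [hω.eq, List.length_cons, cs.wordProd_cons, mul_assoc] at h1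
    rw [hω'.eq] at h2
    rw [cs.wordProd_cons, mul_assoc]
    exact (ih hωJ' hω').trans (bruhatLE_simple_mul (by omega))

theorem bruhatLE_mul_of_mem_minRight {J : Set B} {p u : W} (hp : p ∈ minRight cs J)
    (hu : u ∈ parabolic cs J) : bruhatLE cs p (p * u) := by
  have hp' : p⁻¹ ∈ minLeft cs J := (inv_mem_minRight_iff cs).1 (by rwa [inv_inv])
  simpa using (bruhatLE_mul_of_mem_minLeft hp' (inv_mem hu)).inv

/-- If `x < xt` for a reflection `t` and `x < sx ≠ xt` for a simple reflection `s`, then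
`sx < sxt`. -/
theorem length_simple_mul_lt_of_ne {x t : W} {i : B} (ht : cs.IsReflection t)
    (hxt : cs.length x < cs.length (x * t)) (hx : cs.length x < cs.length (cs.simple i * x))
    (hne : x * t ≠ cs.simple i * x) :
    cs.length (cs.simple i * x) < cs.length (cs.simple i * (x * t)) := by
  by_contra hle
  rw [← mul_assoc] at hle
  have hne' := ht.length_mul_left_ne (cs.simple i * x)
  obtain ⟨ω, hω, rfl⟩ := cs.exists_isReduced x
  have hlen := hω.eq
  rw [← cs.wordProd_cons] at hle hne'
  obtain ⟨j, hj, hjt⟩ := exists_eraseIdx_of_length_mul_lt cs (i :: ω) ht (by omega)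
  cases j with
  | zero =>
    rw [List.eraseIdx_cons_zero, cs.wordProd_cons, mul_assoc] at hjt
    apply hne
    nth_rw 2 [← hjt]
    rw [cs.simple_mul_simple_cancel_left]
  | succ j =>
    rw [List.eraseIdx_cons_succ, cs.wordProd_cons, cs.wordProd_cons, mul_assoc,
      mul_right_inj] at hjt
    rw [hjt] at hxt
    have h1 := cs.length_wordProd_le (ω.eraseIdx j)
    have h2 := List.length_eraseIdx_add_one (l := ω) (i := j) (by simpa using hj)
    omega

/-- The map sending `w` to the shorter of `w` and `sw` is monotone for the Bruhat order. -/
theorem bruhatLE_ite_simple_mul {x y : W} (h : bruhatLE cs x y) (i : B) :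
    bruhatLE cs (if cs.IsLeftDescent x i then cs.simple i * x else x)
      (if cs.IsLeftDescent y i then cs.simple i * y else y) := by
  refine Relation.ReflTransGen.lift'
    (fun w => if cs.IsLeftDescent w i then cs.simple i * w else w) ?_ x y h
  rintro x _ ⟨t, ht, rfl, hlt⟩
  have hstep : bruhatLE cs x (x * t) := Relation.ReflTransGen.single ⟨t, ht, rfl, hlt⟩
  have hdesc : cs.IsLeftDescent x i → bruhatLE cs (cs.simple i * x) x := fun hx => by
    have := bruhatLE_simple_mul (cs := cs) (w := cs.simple i * x) (i := i)
    rw [cs.simple_mul_simple_cancel_left] at this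
    exact this hx
  change bruhatLE cs (if cs.IsLeftDescent x i then cs.simple i * x else x)
    (if cs.IsLeftDescent (x * t) i then cs.simple i * (x * t) else x * t)
  split_ifs with hx hy hy
  · refine Relation.ReflTransGen.single ⟨t, ht, (mul_assoc _ _ _).symm, ?_⟩
    rw [cs.isLeftDescent_iff] at hx hy
    omega
  · exact (hdesc hx).trans hstep
  · rw [cs.not_isLeftDescent_iff] at hx
    by_cases hne : x * t = cs.simple i * x
    · rw [hne, cs.simple_mul_simple_cancel_left]
      exact Relation.ReflTransGen.refl
    · refine (bruhatLE_simple_mul (by omega)).trans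
        (Relation.ReflTransGen.single ⟨t, ht, (mul_assoc _ _ _).symm, ?_⟩)
      exact length_simple_mul_lt_of_ne ht hlt (by omega) hne
  · exact hstep

theorem not_isLeftDescent_of_mem_minLeft {J : Set B} {p : W} (hp : p ∈ minLeft cs J) {i : B}
    (hi : i ∈ J) : ¬ cs.IsLeftDescent p i := by
  have h := hp _ (Subgroup.subset_closure ⟨i, hi, rfl⟩)
  rw [cs.length_simple] at h
  rw [cs.not_isLeftDescent_iff]
  omega

theorem bruhatLE_of_bruhatLE_mul {J : Set B} {x p u : W} (hx : x ∈ minLeft cs J)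
    (hp : p ∈ minLeft cs J) (hu : u ∈ parabolic cs J) (h : bruhatLE cs x (u * p)) :
    bruhatLE cs x p := by
  obtain ⟨ω, hωJ, hω, rfl⟩ := exists_isReduced_of_mem_parabolic cs hu
  clear hu
  induction ω with
  | nil => simpa using h
  | cons i ω ih =>
    have hωJ' : ∀ k ∈ ω, k ∈ J := fun k hk => hωJ k (List.mem_cons_of_mem i hk)
    have hω' := isReduced_of_cons cs hω
    refine ih hωJ' hω' ?_
    have h1 := hp _ (wordProd_mem_parabolic cs hωJ)
    have h2 := hp _ (wordProd_mem_parabolic cs hωJ')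
    rw [hω.eq, List.length_cons] at h1
    rw [hω'.eq] at h2
    have e : cs.simple i * (cs.wordProd (i :: ω) * p) = cs.wordProd ω * p := by
      rw [cs.wordProd_cons, mul_assoc, cs.simple_mul_simple_cancel_left]
    have hdesc : cs.IsLeftDescent (cs.wordProd (i :: ω) * p) i := by
      rw [CoxeterSystem.IsLeftDescent, e]
      omega
    have h3 := bruhatLE_ite_simple_mul h i
    rwa [if_neg (not_isLeftDescent_of_mem_minLeft hx (hωJ i List.mem_cons_self)), if_pos hdesc,
      e] at h3

variable (cs)

/-- equivalence of the two descriptions (ii) and (iii) of the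
extended Bruhat order `≤₋₋` for elements in normal form II. -/
theorem statement6 [Finite B] (Θ Θ' : Set B) (hsub : Θ' ⊆ Θ)
    (w₁ w₂ w₁' w₂' : W)
    (h₁ : w₁ ∈ minRight cs (Θ ∪ perp M Θ)) (h₂ : w₂ ∈ minLeft cs Θ)
    (h₁' : w₁' ∈ minRight cs (Θ' ∪ perp M Θ')) (h₂' : w₂' ∈ minLeft cs Θ') :
    (∃ w ∈ parabolic cs (perp M Θ'),
        bruhatLE cs (projR cs Θ (w₁' * w)) w₁ ∧ bruhatLE cs w₂ (projL cs Θ (w⁻¹ * w₂'))) ↔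
    (∃ a ∈ parabolic cs (perp M Θ'), ∃ b ∈ parabolic cs Θ,
        bruhatLE cs (w₁' * (a * b)) w₁ ∧ bruhatLE cs w₂ ((a * b)⁻¹ * w₂')) := by
  constructor
  · rintro ⟨w, hw, hle, hle'⟩
    obtain ⟨-, hb⟩ := projR_spec cs Θ (w₁' * w)
    obtain ⟨hp, hc⟩ := projL_spec cs Θ (w⁻¹ * w₂')
    set q := projR cs Θ (w₁' * w)
    set p := projL cs Θ (w⁻¹ * w₂')
    refine ⟨w, hw, (q⁻¹ * (w₁' * w))⁻¹, inv_mem hb, ?_, ?_⟩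
    · convert hle using 1
      group
    · have h := hle'.trans (bruhatLE_mul_of_mem_minLeft hp (mul_mem hb hc))
      convert h using 1
      group
  · rintro ⟨a, ha, b, hb, hle, hle'⟩
    obtain ⟨hq, hd⟩ := projR_spec cs Θ (w₁' * a)
    obtain ⟨hp, hc⟩ := projL_spec cs Θ (a⁻¹ * w₂')
    refine ⟨a, ha, ?_, ?_⟩
    · refine (bruhatLE_mul_of_mem_minRight hq (mul_mem hd hb)).trans ?_
      convert hle using 1
      group
    · refine bruhatLE_of_bruhatLE_mul h₂ hp (mul_mem (inv_mem hb) hc) ?_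
      convert hle' using 1
      group

end Paper
end

section
/- Let Θ, Θ' ⊆ I, let w₁ ∈ W^Θ, w₂ ∈ ^{Θ∪Θ^⊥}W, w₁' ∈ W^{Θ'}, w₂' ∈ ^{Θ'∪Θ'^⊥}W. Assume Θ ⊇ Θ' and that there exists w ∈ W_{Θ'^⊥} with w₁ ≥ (w₁'w)^Θ and w₂ ≥ ^Θ(w⁻¹w₂') in the Bruhat order; assume also Θ' ⊇ Θ and that there exists w̃ ∈ W_{Θ^⊥} with w₁' ≥ (w₁w̃)^{Θ'} and w₂' ≥ ^{Θ'}(w̃⁻¹w₂) in the Bruhat order. Then Θ = Θ', w₁ = w₁' and w₂ = w₂'. (Antisymmetry of the extended Birkhoff order ≤₋₊.) -/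
open Classical

namespace Paper

variable {B : Type*} {M : CoxeterMatrix B} {W : Type*} [Group W]

variable (cs : CoxeterSystem M W)

theorem parabolic_mono {J K : Set B} (h : J ⊆ K) : parabolic cs J ≤ parabolic cs K :=
  Subgroup.closure_mono (Set.image_mono h)

/-- The Bruhat order refines the length: either the elements agree or the length increases. -/
theorem bruhatLE.eq_or_length_lt {cs : CoxeterSystem M W} {x y : W} (h : bruhatLE cs x y) :
    x = y ∨ cs.length x < cs.length y := by
  unfold bruhatLE at h
  induction h with
  | refl => exact Or.inl rfl
  | tail _ hstep ih =>
    obtain ⟨t, -, -, hlt⟩ := hstep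
    rcases ih with rfl | ih
    · exact Or.inr hlt
    · exact Or.inr (ih.trans hlt)

theorem bruhatLE.length_le {cs : CoxeterSystem M W} {x y : W} (h : bruhatLE cs x y) :
    cs.length x ≤ cs.length y := by
  rcases h.eq_or_length_lt with rfl | h
  · exact le_rfl
  · exact h.le

theorem bruhatLE.antisymm {cs : CoxeterSystem M W} {x y : W} (hxy : bruhatLE cs x y)
    (hyx : bruhatLE cs y x) : x = y :=
  hxy.eq_or_length_lt.resolve_right hyx.length_le.not_gt

/-- Minimal-length representatives of cosets in `W/W_J` are unique. -/
theorem eq_of_mem_minRight {J : Set B} {a b : W} (ha : a ∈ minRight cs J)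
    (hb : b ∈ minRight cs J) (hab : a⁻¹ * b ∈ parabolic cs J) : a = b := by
  have h₁ := ha _ hab
  have h₂ := hb _ (inv_mem hab)
  rw [cs.length_inv] at h₂
  simp only [mul_inv_rev, inv_inv, mul_inv_cancel_left] at h₁ h₂
  have h₀ : cs.length (a⁻¹ * b) = 0 := by omega
  exact inv_mul_eq_one.mp (cs.length_eq_zero_iff.mp h₀)

theorem projR_mul_of_mem {J : Set B} {a u : W} (ha : a ∈ minRight cs J)
    (hu : u ∈ parabolic cs J) : projR cs J (a * u) = a := by
  have hex : ∃ b, b ∈ minRight cs J ∧ b⁻¹ * (a * u) ∈ parabolic cs J := ⟨a, ha, by simpa⟩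
  rw [projR, dif_pos hex]
  obtain ⟨hb, hbu⟩ := hex.choose_spec
  refine eq_of_mem_minRight cs hb ha ?_
  simpa [mul_assoc] using mul_mem hbu (inv_mem hu)

theorem exists_projL_eq_mul (J : Set B) (w : W) :
    ∃ v ∈ parabolic cs J, projL cs J w = v * w := by
  unfold projL
  split_ifs with h
  · exact ⟨_, inv_mem h.choose_spec.2, by simp⟩
  · exact ⟨1, one_mem _, by simp⟩

/-- The projection of `w⁻¹ y` to `^ΘW` has the form `x y` with `x ∈ W_{Θ ∪ Θ^⊥}`, and its length
is at least that of `y`, with equality only if `w ∈ W_Θ`. -/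
theorem length_projL_inv_mul {Θ : Set B} {w y : W} (hw : w ∈ parabolic cs (perp M Θ))
    (hy : y ∈ minLeft cs (Θ ∪ perp M Θ)) :
    cs.length y ≤ cs.length (projL cs Θ (w⁻¹ * y)) ∧
      (cs.length (projL cs Θ (w⁻¹ * y)) ≤ cs.length y →
        projL cs Θ (w⁻¹ * y) = y ∧ w ∈ parabolic cs Θ) := by
  obtain ⟨v, hv, hp⟩ := exists_projL_eq_mul cs Θ (w⁻¹ * y)
  have hlen := hy (v * w⁻¹) (mul_mem (parabolic_mono cs Set.subset_union_left hv)
    (inv_mem (parabolic_mono cs Set.subset_union_right hw)))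
  rw [hp, ← mul_assoc, hlen]
  refine ⟨Nat.le_add_left _ _, fun hle => ?_⟩
  have hone : v * w⁻¹ = 1 := cs.length_eq_zero_iff.mp (by omega)
  exact ⟨by rw [hone, one_mul], mul_inv_eq_one.mp hone ▸ hv⟩

/-- antisymmetry of the extended Birkhoff order `≤₋₊`
(for elements in normal form I, described combinatorially). -/
theorem statement8 [Finite B] (Θ Θ' : Set B) (w₁ w₂ w₁' w₂' : W)
    (h₁ : w₁ ∈ minRight cs Θ) (h₂ : w₂ ∈ minLeft cs (Θ ∪ perp M Θ))
    (h₁' : w₁' ∈ minRight cs Θ') (h₂' : w₂' ∈ minLeft cs (Θ' ∪ perp M Θ'))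
    (hsub : Θ' ⊆ Θ)
    (h : ∃ w ∈ parabolic cs (perp M Θ'),
        bruhatLE cs (projR cs Θ (w₁' * w)) w₁ ∧ bruhatLE cs (projL cs Θ (w⁻¹ * w₂')) w₂)
    (hsub' : Θ ⊆ Θ')
    (h' : ∃ w ∈ parabolic cs (perp M Θ),
        bruhatLE cs (projR cs Θ' (w₁ * w)) w₁' ∧ bruhatLE cs (projL cs Θ' (w⁻¹ * w₂)) w₂') :
    Θ = Θ' ∧ w₁ = w₁' ∧ w₂ = w₂' := by
  obtain rfl : Θ = Θ' := hsub'.antisymm hsub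
  obtain ⟨w, hw, hle₁, hle₂⟩ := h
  obtain ⟨w', hw', hle₁', hle₂'⟩ := h'
  obtain ⟨hlen, heq⟩ := length_projL_inv_mul cs hw h₂'
  obtain ⟨hlen', heq'⟩ := length_projL_inv_mul cs hw' h₂
  have hb := hle₂.length_le
  have hb' := hle₂'.length_le
  obtain ⟨hp, hwΘ⟩ := heq (by omega)
  obtain ⟨hp', hwΘ'⟩ := heq' (by omega)
  rw [projR_mul_of_mem cs h₁' hwΘ] at hle₁
  rw [projR_mul_of_mem cs h₁ hwΘ'] at hle₁'
  rw [hp] at hle₂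
  rw [hp'] at hle₂'
  exact ⟨rfl, hle₁'.antisymm hle₁, hle₂'.antisymm hle₂⟩

end Paper
end
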